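/- arXiv:2512.23839 — 9 statements merged into one kernel-verified Lean document; each statement's English description precedes it below -/
import Mathlib

section
/- Let P be a prime ideal of ℬ[x]. Then the set 𝔄_P = {a ≥ 1 : 1+x^a ∈ P} is a prime subset of the positive integers; that is, for all positive integers a, b, if 1+x^{a+b} ∈ P then 1+x^a ∈ P or 1+x^b ∈ P. -/
/-- The Boolean semifield `𝔹 = {0, 1}` with `1 + 1 = 1`
    (addition is `∨`, multiplication is `∧`). -/
def BoolSemiring : Type := Bool

namespace BoolSemiring

instance : Zero BoolSemiring := ⟨(false : Bool)⟩
instance : One BoolSemiring := ⟨(true : Bool)⟩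
instance : Add BoolSemiring := ⟨fun a b => ((a : Bool) || (b : Bool) : Bool)⟩
instance : Mul BoolSemiring := ⟨fun a b => ((a : Bool) && (b : Bool) : Bool)⟩
instance : DecidableEq BoolSemiring := fun a b => instDecidableEqBool a b
instance : Fintype BoolSemiring := Bool.fintype

instance : CommSemiring BoolSemiring where
  add_assoc := by decide
  zero_add := by decide
  add_zero := by decide
  add_comm := by decide
  mul_assoc := by decide
  one_mul := by decide
  mul_one := by decide
  zero_mul := by decide
  mul_zero := by decide
  left_distrib := by decide
  right_distrib := by decide
  mul_comm := by decide
  nsmul := nsmulRec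

end BoolSemiring

notation "𝔹" => BoolSemiring

open Polynomial

section IdempotentSemiring

variable {R : Type*} [CommSemiring R]

theorem sum_add_eq_sum_of_mem {ι : Type*} (hidem : ∀ x : R, x + x = x) {s : Finset ι}
    (f : ι → R) {i : ι} (hi : i ∈ s) : ∑ j ∈ s, f j + f i = ∑ j ∈ s, f j := by
  classical
  rw [← Finset.sum_erase_add s f hi, add_assoc, hidem]

theorem one_add_pow_eq_sum_of_idem (hidem : ∀ x : R, x + x = x) (u : R) (n : ℕ) :
    (1 + u) ^ n = ∑ k ∈ Finset.range (n + 1), u ^ k := by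
  induction n with
  | zero => simp
  | succ n ih =>
    rw [pow_succ, ih, mul_add, mul_one, Finset.sum_mul]
    simp only [← pow_succ]
    rw [Finset.sum_range_succ (fun k => u ^ (k + 1)) n, ← add_assoc,
      Finset.sum_range_succ (fun k => u ^ k) (n + 1)]
    congr 1
    rw [Finset.sum_range_succ', add_right_comm, hidem]

/-- In an additively idempotent semiring, a finite sum lies in an ideal as soon as every summand
has a partner among the summands such that the two add up to an element of the ideal. -/
theorem sum_mem_of_forall_exists_add_mem {ι : Type*} (hidem : ∀ x : R, x + x = x) (I : Ideal R)
    {s : Finset ι} (f : ι → R) (h : ∀ i ∈ s, ∃ j ∈ s, f i + f j ∈ I) : ∑ i ∈ s, f i ∈ I := by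
  classical
  choose! φ hφ hI using h
  have absorb : ∀ t ⊆ s, ∑ i ∈ s, f i + ∑ i ∈ t, f (φ i) = ∑ i ∈ s, f i := by
    intro t
    induction t using Finset.induction_on with
    | empty => simp
    | insert i t hi ih =>
      intro hts
      rw [Finset.insert_subset_iff] at hts
      rw [Finset.sum_insert hi, ← add_assoc, sum_add_eq_sum_of_mem hidem f (hφ i hts.1),
        ih hts.2]
  rw [← absorb s subset_rfl, ← Finset.sum_add_distrib]
  exact I.sum_mem hI

theorem one_add_pow_mul_one_add_pow_mem (hidem : ∀ x : R, x + x = x) (I : Ideal R) {u v : R}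
    {a b : ℕ} (hb : 0 < b) (huv : u ^ b = v ^ a) (hI : 1 + u * v ∈ I) :
    (1 + u) ^ b * (1 + v) ^ (a + 1) ∈ I := by
  rw [one_add_pow_eq_sum_of_idem hidem, one_add_pow_eq_sum_of_idem hidem, Finset.sum_mul_sum,
    ← Finset.sum_product']
  refine sum_mem_of_forall_exists_add_mem hidem I _ ?_
  rintro ⟨k, l⟩ hkl
  simp only [Finset.mem_product, Finset.mem_range] at hkl
  simp only [Prod.exists, Finset.mem_product, Finset.mem_range]
  by_cases h₁ : k < b ∧ l < a + 1
  · refine ⟨k + 1, l + 1, by omega, ?_⟩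
    convert I.mul_mem_left (u ^ k * v ^ l) hI using 1
    ring
  by_cases h₂ : 0 < k ∧ 0 < l
  · obtain ⟨k, rfl⟩ := Nat.exists_eq_add_of_lt h₂.1
    obtain ⟨l, rfl⟩ := Nat.exists_eq_add_of_lt h₂.2
    refine ⟨k, l, by omega, ?_⟩
    convert I.mul_mem_left (u ^ k * v ^ l) hI using 1
    ring
  obtain ⟨rfl, rfl⟩ | ⟨rfl, rfl⟩ : (k = b ∧ l = 0) ∨ (k = 0 ∧ l = a + 1) := by omega
  · refine ⟨1, a + 1, by omega, ?_⟩
    convert I.mul_mem_left (u ^ k) hI using 1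
    rw [pow_succ v a, ← huv]
    ring
  · obtain ⟨c, rfl⟩ := Nat.exists_eq_add_of_lt hb
    refine ⟨c, 0, by omega, ?_⟩
    convert I.mul_mem_left (u ^ c) hI using 1
    rw [pow_succ v a, ← huv]
    ring

end IdempotentSemiring

theorem BoolSemiring.polynomial_add_self (p : Polynomial 𝔹) : p + p = p := by
  ext n
  rw [coeff_add]
  exact (by decide : ∀ x : 𝔹, x + x = x) _

theorem stmt_1 (P : Ideal (Polynomial 𝔹)) (hP : P.IsPrime)
    (a b : ℕ) (ha : 0 < a) (hb : 0 < b)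
    (hab : (1 : Polynomial 𝔹) + X ^ (a + b) ∈ P) :
    (1 : Polynomial 𝔹) + X ^ a ∈ P ∨ (1 : Polynomial 𝔹) + X ^ b ∈ P := by
  rw [pow_add] at hab
  have hpow : ((X : Polynomial 𝔹) ^ a) ^ b = (X ^ b) ^ a := pow_right_comm _ _ _
  exact (hP.mem_or_mem (one_add_pow_mul_one_add_pow_mem BoolSemiring.polynomial_add_self P hb
    hpow hab)).imp (hP.mem_of_pow_mem _) (hP.mem_of_pow_mem _)
end

section
/- Let J be a prime ideal of ℬ[x] and let a, q be positive integers with q ≤ a and 1+x^a ∈ J. Then 1+x^q+x^a ∈ J. -/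
open Polynomial

theorem one_add_pow_add_pow_of_le {R : Type*} [CommSemiring R] (hR : ∀ r : R, r + r = r)
    (z : R) {n k : ℕ} (hk : k ≤ n) : (1 + z) ^ n + z ^ k = (1 + z) ^ n := by
  induction n generalizing k with
  | zero =>
    obtain rfl : k = 0 := by omega
    simpa using hR 1
  | succ n ih =>
    rcases Nat.le_succ_iff.mp hk with h | rfl
    · calc (1 + z) ^ (n + 1) + z ^ k = ((1 + z) ^ n + z ^ k) + z * (1 + z) ^ n := by ring
        _ = (1 + z) ^ (n + 1) := by rw [ih h]; ring
    · calc (1 + z) ^ (n + 1) + z ^ (n + 1) = (1 + z) ^ n + z * ((1 + z) ^ n + z ^ n) := by ring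
        _ = (1 + z) ^ (n + 1) := by rw [ih le_rfl]; ring

theorem exists_add_pow_succ_eq {R : Type*} [CommSemiring R] (c y : R) (n : ℕ) :
    ∃ r, (c + y) ^ (n + 1) = c ^ (n + 1) + y ^ (n + 1) + c * r := by
  induction n with
  | zero => exact ⟨0, by ring⟩
  | succ n ih =>
    obtain ⟨r, hr⟩ := ih
    exact ⟨y ^ (n + 1) + (c + y) * r + y * c ^ n, by rw [pow_succ, hr]; ring⟩

theorem stmt_3 (J : Ideal (Polynomial 𝔹)) (hJ : J.IsPrime)
    (a q : ℕ) (hq : 0 < q) (hqa : q ≤ a)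
    (ha : (1 : Polynomial 𝔹) + X ^ a ∈ J) :
    (1 : Polynomial 𝔹) + X ^ q + X ^ a ∈ J := by
  obtain ⟨n, rfl⟩ : ∃ n, a = n + 1 := ⟨a - 1, by omega⟩
  obtain ⟨r, hr⟩ := exists_add_pow_succ_eq (1 + X ^ (n + 1) : Polynomial 𝔹) (X ^ q) n
  refine hJ.mem_of_pow_mem (n + 1) ?_
  rw [add_right_comm, hr, pow_right_comm X q,
    one_add_pow_add_pow_of_le BoolSemiring.polynomial_add_self _ hqa]
  exact J.add_mem (J.pow_mem_of_mem ha _ n.succ_pos) (J.mul_mem_right r ha)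
end

section
/- Let α ≥ 1 and m be integers with m − 1 > α, and set q = mα + Σ_{i=1}^{α−1}(α+i) = α(2m+3α−3)/2. Then in ℬ[x] one has the identity (1+x^α)^m · ∏_{i=1}^{α−1}(1+x^{α+i}) = 1 + Σ_{j=α}^{q−α} x^j + x^q; that is, the product is the polynomial whose support consists exactly of 1, all monomials x^j with α ≤ j ≤ q−α, and x^q. -/
open Polynomial

namespace BoolSemiring

theorem eq_of_ne_zero_iff : ∀ {a b : 𝔹}, (a ≠ 0 ↔ b ≠ 0) → a = b := by decide

theorem add_ne_zero_iff : ∀ {a b : 𝔹}, a + b ≠ 0 ↔ a ≠ 0 ∨ b ≠ 0 := by decide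

theorem one_ne_zero : (1 : 𝔹) ≠ 0 := by decide

theorem coeff_one_add_X_pow_mul_ne_zero {e n : ℕ} {f : 𝔹[X]} :
    ((1 + X ^ e) * f).coeff n ≠ 0 ↔ f.coeff n ≠ 0 ∨ (e ≤ n ∧ f.coeff (n - e) ≠ 0) := by
  rw [add_mul, one_mul, coeff_add, add_ne_zero_iff, coeff_X_pow_mul']
  split_ifs with h <;> simp [h]

theorem coeff_one_add_X_pow_mul_of_left {e n : ℕ} {f : 𝔹[X]} (h : f.coeff n ≠ 0) :
    ((1 + X ^ e) * f).coeff n ≠ 0 :=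
  coeff_one_add_X_pow_mul_ne_zero.2 (.inl h)

theorem coeff_one_add_X_pow_mul_of_right {e n : ℕ} {f : 𝔹[X]} (h : f.coeff n ≠ 0) :
    ((1 + X ^ e) * f).coeff (n + e) ≠ 0 :=
  coeff_one_add_X_pow_mul_ne_zero.2 (.inr ⟨by omega, by simpa using h⟩)

/-- `f` has nonzero coefficients at `0` and `d`, and all its other exponents lie in
`[α, d - α]`. -/
structure IsGapped (α : ℕ) (f : 𝔹[X]) (d : ℕ) : Prop where
  degree_bound : d = 0 ∨ α ≤ d
  coeff_zero : f.coeff 0 ≠ 0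
  coeff_top : f.coeff d ≠ 0
  support : ∀ n, f.coeff n ≠ 0 → n = 0 ∨ n = d ∨ (α ≤ n ∧ n + α ≤ d)

theorem isGapped_one (α : ℕ) : IsGapped α 1 0 where
  degree_bound := .inl rfl
  coeff_zero := by simp [one_ne_zero]
  coeff_top := by simp [one_ne_zero]
  support n hn := by
    by_contra! h
    exact hn (by simp [coeff_one, h.1])

theorem IsGapped.one_add_X_pow_mul {α d e : ℕ} {f : 𝔹[X]} (hf : IsGapped α f d) (he : α ≤ e) :
    IsGapped α ((1 + X ^ e) * f) (e + d) where
  degree_bound := .inr (by omega)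
  coeff_zero := coeff_one_add_X_pow_mul_of_left hf.coeff_zero
  coeff_top := by
    rw [add_comm e d]
    exact coeff_one_add_X_pow_mul_of_right hf.coeff_top
  support n hn := by
    have hd := hf.degree_bound
    rcases coeff_one_add_X_pow_mul_ne_zero.1 hn with h | ⟨hen, h⟩ <;>
      have := hf.support _ h <;> omega

theorem IsGapped.one_add_X_pow_pow_mul {α d : ℕ} {f : 𝔹[X]} (hf : IsGapped α f d) (m : ℕ) :
    IsGapped α ((1 + X ^ α) ^ m * f) (m * α + d) := by
  induction m with
  | zero => simpa using hf
  | succ m ih =>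
    have := ih.one_add_X_pow_mul le_rfl
    rwa [← mul_assoc, ← pow_succ', ← add_assoc, show α + m * α = (m + 1) * α by ring] at this

theorem isGapped_prod (α : ℕ) (s : Finset ℕ) :
    IsGapped α (∏ i ∈ s, ((1 : 𝔹[X]) + X ^ (α + i))) (∑ i ∈ s, (α + i)) := by
  induction s using Finset.induction_on with
  | empty => simpa using isGapped_one α
  | insert a s ha ih =>
    rw [Finset.prod_insert ha, Finset.sum_insert ha]
    exact ih.one_add_X_pow_mul (by omega)

theorem coeff_one_add_X_pow_pow_ne_zero (α : ℕ) {m t : ℕ} (ht : t ≤ m) :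
    (((1 : 𝔹[X]) + X ^ α) ^ m).coeff (t * α) ≠ 0 := by
  induction m generalizing t with
  | zero =>
    obtain rfl : t = 0 := by omega
    simp [one_ne_zero]
  | succ m ih =>
    rw [pow_succ']
    rcases t with _ | t
    · exact coeff_one_add_X_pow_mul_of_left (ih (Nat.zero_le m))
    · rw [add_mul t, Nat.one_mul]
      exact coeff_one_add_X_pow_mul_of_right (ih (Nat.le_of_succ_le_succ ht))

/-- The partial product of `(1 + X ^ α) ^ m` with the first `k` pairs of factors whose exponents
sum to `3 * α`. -/
noncomputable def pairedProd (α m k : ℕ) : 𝔹[X] :=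
  (1 + X ^ α) ^ m *
    ∏ i ∈ Finset.range k, ((1 + X ^ (α + (i + 1))) * (1 + X ^ (α + (α - 1 - i))))

theorem pairedProd_succ (α m k : ℕ) :
    pairedProd α m (k + 1) =
      (1 + X ^ (α + (k + 1))) * ((1 + X ^ (α + (α - 1 - k))) * pairedProd α m k) := by
  rw [pairedProd, pairedProd, Finset.prod_range_succ]
  ring

theorem coeff_pairedProd_ne_zero {α m k : ℕ} (hm : 2 ≤ m) (hk : k < α) :
    (∀ t ≤ m + 3 * k, (pairedProd α m k).coeff (t * α) ≠ 0) ∧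
      ∀ i < k, ∀ t, t + 3 ≤ m + 3 * k →
        (pairedProd α m k).coeff (α + (i + 1) + t * α) ≠ 0 ∧
          (pairedProd α m k).coeff (α + (α - 1 - i) + t * α) ≠ 0 := by
  induction k with
  | zero =>
    refine ⟨fun t ht => ?_, fun i hi => by omega⟩
    simpa [pairedProd] using coeff_one_add_X_pow_pow_ne_zero α (m := m) (t := t) (by omega)
  | succ k ih =>
    obtain ⟨ih₀, ih₁⟩ := ih (by omega)
    have keep {n : ℕ} (h : (pairedProd α m k).coeff n ≠ 0) :
        (pairedProd α m (k + 1)).coeff n ≠ 0 := by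
      rw [pairedProd_succ]
      exact coeff_one_add_X_pow_mul_of_left (coeff_one_add_X_pow_mul_of_left h)
    have shift {n n' : ℕ} (h : (pairedProd α m k).coeff n ≠ 0) (hn : n' = n + 3 * α) :
        (pairedProd α m (k + 1)).coeff n' ≠ 0 := by
      rw [pairedProd_succ,
        show n' = n + (α + (α - 1 - k)) + (α + (k + 1)) by omega]
      exact coeff_one_add_X_pow_mul_of_right (coeff_one_add_X_pow_mul_of_right h)
    refine ⟨fun t ht => ?_, fun i hi t ht => ?_⟩
    · by_cases h : t ≤ m + 3 * k
      · exact keep (ih₀ t h)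
      · obtain ⟨s, rfl⟩ := Nat.exists_eq_add_of_le' (show 3 ≤ t by omega)
        exact shift (ih₀ s (by omega)) (by ring)
    · rcases Nat.lt_succ_iff_lt_or_eq.1 hi with hi | rfl
      · by_cases h : t + 3 ≤ m + 3 * k
        · exact ⟨keep (ih₁ i hi t h).1, keep (ih₁ i hi t h).2⟩
        · obtain ⟨s, rfl⟩ := Nat.exists_eq_add_of_le' (show 3 ≤ t by omega)
          have := ih₁ i hi s (by omega)
          exact ⟨shift this.1 (by ring), shift this.2 (by ring)⟩
      · have h := ih₀ t (by omega)
        rw [pairedProd_succ]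
        constructor
        · rw [add_comm _ (t * α)]
          exact coeff_one_add_X_pow_mul_of_right (coeff_one_add_X_pow_mul_of_left h)
        · rw [add_comm _ (t * α)]
          exact coeff_one_add_X_pow_mul_of_left (coeff_one_add_X_pow_mul_of_right h)

theorem prod_Icc_eq_prod_range {M : Type*} [CommMonoid M] (f : ℕ → M) (n : ℕ) :
    ∏ i ∈ Finset.Icc 1 n, f i = ∏ i ∈ Finset.range n, f (i + 1) := by
  induction n with
  | zero => simp
  | succ n ih => rw [Finset.prod_Icc_succ_top (by omega), ih, Finset.prod_range_succ]

theorem prod_Icc_two_mul {M : Type*} [CommMonoid M] (f : ℕ → M) (k : ℕ) :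
    ∏ i ∈ Finset.Icc 1 (2 * k), f i = ∏ i ∈ Finset.range k, (f (i + 1) * f (2 * k - i)) := by
  rw [prod_Icc_eq_prod_range, two_mul, Finset.prod_range_add, Finset.prod_mul_distrib,
    ← Finset.prod_range_reflect (fun i => f (k + i + 1))]
  congr 1
  refine Finset.prod_congr rfl fun i hi => ?_
  rw [Finset.mem_range] at hi
  congr 1
  omega

theorem prod_Icc_two_mul_add_one {M : Type*} [CommMonoid M] (f : ℕ → M) (k : ℕ) :
    ∏ i ∈ Finset.Icc 1 (2 * k + 1), f i =
      f (k + 1) * ∏ i ∈ Finset.range k, (f (i + 1) * f (2 * k + 1 - i)) := by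
  rw [prod_Icc_eq_prod_range, show 2 * k + 1 = k + 1 + k by omega, Finset.prod_range_add,
    Finset.prod_range_succ, Finset.prod_mul_distrib,
    ← Finset.prod_range_reflect (fun i => f (k + 1 + i + 1)), mul_comm (∏ _ ∈ _, _), mul_assoc]
  congr 2
  refine Finset.prod_congr rfl fun i hi => ?_
  rw [Finset.mem_range] at hi
  congr 1
  omega

theorem two_mul_sum_Icc_add (α n : ℕ) :
    2 * ∑ i ∈ Finset.Icc 1 n, (α + i) = n * (2 * α + n + 1) := by
  induction n with
  | zero => simp
  | succ n ih =>
    rw [Finset.sum_Icc_succ_top (by omega), mul_add, ih]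
    ring

theorem coeff_ne_zero_of_odd {k m n : ℕ} (hm : 2 ≤ m) (hn : 2 * k + 1 ≤ n)
    (hn' : n + (2 * k + 1) ≤ (m + 3 * k) * (2 * k + 1)) :
    (pairedProd (2 * k + 1) m k).coeff n ≠ 0 := by
  obtain ⟨h₀, h₁⟩ := coeff_pairedProd_ne_zero (k := k) (α := 2 * k + 1) hm (by omega)
  generalize hα : 2 * k + 1 = α at *
  obtain ⟨a, r, hr, rfl⟩ : ∃ a r, r < α ∧ n = r + (a + 1) * α := by
    refine ⟨n / α - 1, n % α, Nat.mod_lt _ (by omega), ?_⟩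
    rw [Nat.sub_add_cancel (Nat.div_pos hn (by omega)), mul_comm]
    exact (Nat.mod_add_div n α).symm
  have ha : (a + 2) * α ≤ (m + 3 * k) * α := by linarith
  replace ha := Nat.le_of_mul_le_mul_right ha (by omega)
  rcases Nat.eq_zero_or_pos r with rfl | hr0
  · simpa using h₀ (a + 1) (by omega)
  · have ha' : a + 3 ≤ m + 3 * k := by
      by_contra! h
      obtain h : m + 3 * k = a + 2 := by omega
      rw [h] at hn'
      linarith
    by_cases hrk : r ≤ k
    · convert (h₁ (r - 1) (by omega) a ha').1 using 2
      rw [Nat.sub_add_cancel hr0]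
      ring
    · convert (h₁ (α - 1 - r) (by omega) a ha').2 using 2
      rw [show α - 1 - (α - 1 - r) = r by omega]
      ring

theorem coeff_ne_zero_of_even {k m n : ℕ} (hm : 2 ≤ m) (hn : 2 * k + 2 ≤ n)
    (hn' : n + (2 * k + 2) ≤ (m + 3 * k) * (2 * k + 2) + 3 * (k + 1)) :
    ((1 + X ^ (3 * (k + 1))) * pairedProd (2 * k + 2) m k).coeff n ≠ 0 := by
  obtain ⟨h₀, h₁⟩ := coeff_pairedProd_ne_zero (k := k) (α := 2 * k + 2) hm (by omega)
  generalize hα : 2 * k + 2 = α at *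
  obtain ⟨a, r, hr, rfl⟩ : ∃ a r, r < α ∧ n = r + (a + 1) * α := by
    refine ⟨n / α - 1, n % α, Nat.mod_lt _ (by omega), ?_⟩
    rw [Nat.sub_add_cancel (Nat.div_pos hn (by omega)), mul_comm]
    exact (Nat.mod_add_div n α).symm
  have keep {n n' : ℕ} (h : (pairedProd α m k).coeff n ≠ 0) (hn : n' = n) :
      ((1 + X ^ (3 * (k + 1))) * pairedProd α m k).coeff n' ≠ 0 :=
    hn ▸ coeff_one_add_X_pow_mul_of_left h
  have shift {n n' : ℕ} (h : (pairedProd α m k).coeff n ≠ 0) (hn : n' = n + 3 * (k + 1)) :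
      ((1 + X ^ (3 * (k + 1))) * pairedProd α m k).coeff n' ≠ 0 :=
    hn ▸ coeff_one_add_X_pow_mul_of_right h
  have ha : a + 1 ≤ m + 3 * k := by
    by_contra! h
    have := Nat.mul_le_mul_right α (show m + 3 * k + 1 ≤ a + 1 by omega)
    linarith
  have hra : k + 1 < r → a + 2 ≤ m + 3 * k := fun hkr => by
    by_contra! h
    obtain h : m + 3 * k = a + 1 := by omega
    rw [h] at hn'
    linarith
  rcases Nat.eq_zero_or_pos r with rfl | hr0
  · exact keep (h₀ (a + 1) ha) (by ring)
  rcases lt_trichotomy r (k + 1) with hrk | rfl | hrk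
  · by_cases ha' : a + 3 ≤ m + 3 * k
    · refine keep (h₁ (r - 1) (by omega) a ha').1 ?_
      rw [Nat.sub_add_cancel hr0]
      ring
    · obtain ⟨b, rfl⟩ := Nat.exists_eq_add_of_le' (show 2 ≤ a by omega)
      refine shift (h₁ (k - r) (by omega) b (by omega)).2 ?_
      rw [show (b + 2 + 1) * α = b * α + 3 * α by ring]
      omega
  · refine shift (h₀ a (by omega)) ?_
    rw [add_mul]
    omega
  · specialize hra hrk
    by_cases ha' : a + 3 ≤ m + 3 * k
    · refine keep (h₁ (α - 1 - r) (by omega) a ha').2 ?_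
      rw [add_mul]
      omega
    · obtain ⟨b, rfl⟩ := Nat.exists_eq_add_of_le' (show 1 ≤ a by omega)
      refine shift (h₁ (r - (k + 1) - 1) (by omega) b (by omega)).1 ?_
      rw [show (b + 1 + 1) * α = b * α + 2 * α by ring]
      omega

theorem coeff_one_add_sum_Icc_add_ne_zero {a b q n : ℕ} :
    ((1 : 𝔹[X]) + (∑ j ∈ Finset.Icc a b, (X : 𝔹[X]) ^ j) + X ^ q).coeff n ≠ 0 ↔
      n = 0 ∨ (a ≤ n ∧ n ≤ b) ∨ n = q := by
  have ite_ne_zero (p : Prop) [Decidable p] : (if p then (1 : 𝔹) else 0) ≠ 0 ↔ p := by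
    split_ifs with h <;> simp [h, one_ne_zero]
  simp only [coeff_add, add_ne_zero_iff, finsetSum_coeff, coeff_X_pow, coeff_one,
    Finset.sum_ite_eq, ite_ne_zero, Finset.mem_Icc, or_assoc]

theorem coeff_prod_ne_zero {α m q n : ℕ} (hα : 1 ≤ α) (hm : 2 ≤ m)
    (hq : q = m * α + ∑ i ∈ Finset.Icc 1 (α - 1), (α + i)) (hn : α ≤ n) (hn' : n + α ≤ q) :
    (((1 : 𝔹[X]) + X ^ α) ^ m *
      ∏ i ∈ Finset.Icc 1 (α - 1), ((1 : 𝔹[X]) + X ^ (α + i))).coeff n ≠ 0 := by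
  obtain ⟨k, hk⟩ := Nat.even_or_odd' (α - 1)
  rcases hk with hk | hk
  · obtain rfl : α = 2 * k + 1 := by omega
    rw [hk] at hq ⊢
    have hsum := two_mul_sum_Icc_add (2 * k + 1) (2 * k)
    rw [prod_Icc_two_mul]
    have := coeff_ne_zero_of_odd hm hn (by linarith)
    rwa [pairedProd, hk] at this
  · obtain rfl : α = 2 * k + 2 := by omega
    rw [hk] at hq ⊢
    have hsum := two_mul_sum_Icc_add (2 * k + 2) (2 * k + 1)
    rw [prod_Icc_two_mul_add_one, mul_left_comm]
    have := coeff_ne_zero_of_even hm hn (by linarith)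
    rwa [pairedProd, hk, show 3 * (k + 1) = 2 * k + 2 + (k + 1) by ring] at this

end BoolSemiring

theorem stmt_4 (α m q : ℕ) (hα : 1 ≤ α) (hm : α + 1 < m)
    (hq : q = m * α + ∑ i ∈ Finset.Icc 1 (α - 1), (α + i)) :
    ((1 : Polynomial 𝔹) + X ^ α) ^ m *
        ∏ i ∈ Finset.Icc 1 (α - 1), ((1 : Polynomial 𝔹) + X ^ (α + i)) =
      1 + (∑ j ∈ Finset.Icc α (q - α), (X : Polynomial 𝔹) ^ j) + X ^ q := by
  have hgap := (BoolSemiring.isGapped_prod α (Finset.Icc 1 (α - 1))).one_add_X_pow_pow_mul m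
  rw [← hq] at hgap
  have hqα : 2 * α ≤ q := by
    rw [hq]
    exact le_add_right (Nat.mul_le_mul_right α (by omega))
  ext n
  refine BoolSemiring.eq_of_ne_zero_iff ?_
  rw [BoolSemiring.coeff_one_add_sum_Icc_add_ne_zero]
  constructor
  · intro h
    have := hgap.support n h
    omega
  · rintro (rfl | ⟨h, h'⟩ | rfl)
    · exact hgap.coeff_zero
    · exact BoolSemiring.coeff_prod_ne_zero hα (by omega) hq h (by omega)
    · exact hgap.coeff_top
end

section
/- Let J be a prime ideal of ℬ[x] with x ∉ J such that 𝔄_J = {a ≥ 1 : 1+x^a ∈ J} is finite and nonempty. Then {1+x+x^q : q ≥ 1} ⊆ J if and only if there exists a positive integer m such that 1+x+x^m ∈ J, m ∉ 𝔄_J, and m−1 ∉ 𝔄_J. -/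
open Polynomial

/-- The set `𝔄_J = {a ≥ 1 : 1 + x^a ∈ J}` associated to an ideal `J` of `𝔹[x]`. -/
def AJ (J : Ideal (Polynomial 𝔹)) : Set ℕ :=
  {a : ℕ | 1 ≤ a ∧ (1 : Polynomial 𝔹) + X ^ a ∈ J}

namespace BoolSemiring

theorem polynomial_add_self_s7 (p : Polynomial 𝔹) : p + p = p := by
  ext n
  rw [coeff_add]
  generalize p.coeff n = c
  revert c
  decide

theorem one_add_X_pow (n : ℕ) :
    (1 + X : Polynomial 𝔹) ^ n = ∑ i ∈ Finset.range (n + 1), X ^ i := by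
  have key : ∀ n : ℕ, (1 + X : Polynomial 𝔹) * ∑ i ∈ Finset.range (n + 1), X ^ i =
      ∑ i ∈ Finset.range (n + 2), X ^ i := by
    intro n
    induction n with
    | zero => simp [Finset.sum_range_succ]
    | succ k ih =>
      rw [Finset.sum_range_succ, mul_add, ih, Finset.sum_range_succ _ (k + 2),
        Finset.sum_range_succ _ (k + 1)]
      have h := polynomial_add_self_s7 (X ^ (k + 1))
      calc _ = ∑ i ∈ Finset.range (k + 1), (X : Polynomial 𝔹) ^ i +
            (X ^ (k + 1) + X ^ (k + 1)) + X ^ (k + 2) := by ring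
        _ = _ := by rw [h]
  induction n with
  | zero => simp
  | succ k ih => rw [pow_succ', ih, key]

theorem two_eq_one : (2 : Polynomial 𝔹) = 1 := by
  rw [← one_add_one_eq_two, polynomial_add_self_s7]

theorem three_eq_one : (3 : Polynomial 𝔹) = 1 := by
  rw [← two_add_one_eq_three, two_eq_one, polynomial_add_self_s7]

variable {J : Ideal (Polynomial 𝔹)}

theorem one_add_X_mem (hJ : J.IsPrime) {a : ℕ} (h : (1 : Polynomial 𝔹) + X ^ a ∈ J) :
    (1 : Polynomial 𝔹) + X ∈ J := by
  refine hJ.mem_of_pow_mem (a + a) ?_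
  have e : (1 + X : Polynomial 𝔹) ^ (a + a) =
      (1 + X ^ a) * ∑ i ∈ Finset.range (a + 1), X ^ i := by
    rw [one_add_X_pow, add_mul, one_mul, Finset.mul_sum, Finset.sum_range_succ _ a, add_assoc a,
      Finset.sum_range_add, add_assoc]
    simp only [← pow_add]
    rw [Finset.sum_range_succ' _ a, add_zero, add_left_comm (X ^ a), polynomial_add_self_s7]
  rw [e]
  exact J.mul_mem_right _ h

/-- Either every `{0, 1, M}` or every `{0, n, n + 1}` has its indicator polynomial in `J`;
the induction runs the subtractive Euclidean algorithm on `(M, n + 1)`. -/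
theorem right_mem_or_left_mem (hJ : J.IsPrime) (h1 : (1 : Polynomial 𝔹) + X ∈ J) (M n : ℕ) :
    (1 : Polynomial 𝔹) + X + X ^ M ∈ J ∨ (1 : Polynomial 𝔹) + X ^ n + X ^ (n + 1) ∈ J := by
  induction hs : M + n using Nat.strong_induction_on generalizing M n with
  | _ s ih =>
  subst hs
  rcases Nat.eq_zero_or_pos M with rfl | hM
  · left
    have e : (1 : Polynomial 𝔹) + X + X ^ 0 = 1 + X := by
      ring_nf
      simp [two_eq_one]
    rwa [e]
  rcases le_or_gt M n with hle | hlt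
  · obtain ⟨d, rfl⟩ := Nat.exists_eq_add_of_le hle
    rcases ih (M + d) (by omega) M d rfl with h | h
    · exact Or.inl h
    · refine hJ.mem_or_mem ?_
      have e : ((1 : Polynomial 𝔹) + X + X ^ M) * (1 + X ^ (M + d) + X ^ (M + d + 1)) =
          (1 + X ^ (M + d) + X ^ (M + d + 1) + X ^ (M + (M + d))) * (1 + X) +
            X ^ M * (1 + X ^ d + X ^ (d + 1)) := by
        ring_nf
        simp [two_eq_one, three_eq_one]
      rw [e]
      exact J.add_mem (J.mul_mem_left _ h1) (J.mul_mem_left _ h)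
  · obtain ⟨d, rfl⟩ := Nat.exists_eq_add_of_le (Nat.succ_le_of_lt hlt)
    rcases ih (d + n) (by omega) d n rfl with h | h
    · refine hJ.mem_or_mem ?_
      have e : ((1 : Polynomial 𝔹) + X + X ^ (n.succ + d)) * (1 + X ^ n + X ^ (n + 1)) =
          (1 + X ^ n + X ^ (n + 1 + d + n)) * (1 + X) +
            X ^ (n + 1) * (1 + X + X ^ d) := by
        rw [Nat.succ_eq_add_one]
        ring_nf
      rw [e]
      exact J.add_mem (J.mul_mem_left _ h1) (J.mul_mem_left _ h)
    · exact Or.inr h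

/-- If `{0, 1, n + 1}` and `{0, n, n + 1}` lie in `J` but `{0, n}` and `{0, n + 1}` do not,
then every `{0, 1, M}` lies in `J`. -/
theorem right_mem_of_mem (hJ : J.IsPrime) (h1 : (1 : Polynomial 𝔹) + X ∈ J) {n : ℕ}
    (hr : (1 : Polynomial 𝔹) + X + X ^ (n + 1) ∈ J)
    (hl : (1 : Polynomial 𝔹) + X ^ n + X ^ (n + 1) ∈ J)
    (hn : (1 : Polynomial 𝔹) + X ^ n ∉ J) (hn' : (1 : Polynomial 𝔹) + X ^ (n + 1) ∉ J) (M : ℕ) :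
    (1 : Polynomial 𝔹) + X + X ^ M ∈ J := by
  have e : ((1 : Polynomial 𝔹) + X + X ^ M) * (1 + X ^ n) * (1 + X ^ (n + 1)) =
      (1 + X ^ n + X ^ (n + 1) + X ^ (n + (n + 1))) * (1 + X) +
        X ^ M * (1 + X ^ n + X ^ (n + 1)) + X ^ (M + n) * (1 + X + X ^ (n + 1)) := by
    ring_nf
    simp [two_eq_one]
  have hmem : ((1 : Polynomial 𝔹) + X + X ^ M) * (1 + X ^ n) * (1 + X ^ (n + 1)) ∈ J := by
    rw [e]
    exact J.add_mem (J.add_mem (J.mul_mem_left _ h1) (J.mul_mem_left _ hl)) (J.mul_mem_left _ hr)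
  exact (hJ.mem_or_mem ((hJ.mem_or_mem hmem).resolve_right hn')).resolve_right hn

end BoolSemiring

theorem stmt_7 (J : Ideal (Polynomial 𝔹)) (hJ : J.IsPrime)
    (hx : (X : Polynomial 𝔹) ∉ J)
    (hfin : (AJ J).Finite) (hne : (AJ J).Nonempty) :
    (∀ q : ℕ, 1 ≤ q → (1 : Polynomial 𝔹) + X + X ^ q ∈ J) ↔
      ∃ m : ℕ, 1 ≤ m ∧ (1 : Polynomial 𝔹) + X + X ^ m ∈ J ∧
        m ∉ AJ J ∧ m - 1 ∉ AJ J := by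
  constructor
  · intro h
    obtain ⟨N, hN⟩ := hfin.bddAbove
    refine ⟨N + 2, by omega, h _ (by omega), fun hm => ?_, fun hm => ?_⟩
    · have := hN hm
      omega
    · have := hN hm
      omega
  · rintro ⟨m, hm1, hr, hm, hm'⟩ q -
    obtain ⟨a, -, ha⟩ := hne
    have h1 := BoolSemiring.one_add_X_mem hJ ha
    obtain ⟨n, rfl⟩ := Nat.exists_eq_add_of_le' hm1
    have hn0 : 1 ≤ n := by
      by_contra! h0
      obtain rfl : n = 0 := by omega
      exact hm ⟨le_rfl, by simpa using h1⟩
    rcases BoolSemiring.right_mem_or_left_mem hJ h1 q n with h | h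
    · exact h
    · exact BoolSemiring.right_mem_of_mem hJ h1 hr h (fun h => hm' ⟨hn0, h⟩)
        (fun h => hm ⟨hm1, h⟩) q
end

section
/- Let J be a prime ideal of ℬ[x] with x ∉ J such that 𝔄_J = {a ≥ 1 : 1+x^a ∈ J} is finite and nonempty, and let a ∈ 𝔄_J. Then {1+x^a+x^q : q ≥ 1} ⊆ J if and only if there exists an integer m > a such that 1+x^a+x^m ∈ J, m ∉ 𝔄_J, and m−a ∉ 𝔄_J. -/
open Polynomial

theorem natCast_succ_eq_one_of_one_add_one {R : Type*} [CommSemiring R] (h : (1 : R) + 1 = 1) (n : ℕ) :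
    ((n + 1 : ℕ) : R) = 1 := by
  induction n with
  | zero => simp
  | succ n ih => rw [Nat.cast_succ, ih, h]

theorem trinomial_mul_trinomial {R : Type*} [CommSemiring R] (h : (1 : R) + 1 = 1) (A Q S : R) :
    (1 + A + Q) * (1 + A + S) = (1 + A + Q * S) + (1 + A + Q + S) * (1 + A) := by
  have h2 : (2 : R) = 1 := by exact_mod_cast natCast_succ_eq_one_of_one_add_one h 1
  have h3 : (3 : R) = 1 := by exact_mod_cast natCast_succ_eq_one_of_one_add_one h 2
  ring_nf
  simp only [h2, h3, mul_one]

theorem trinomial_mul_binomials {R : Type*} [CommSemiring R] (h : (1 : R) + 1 = 1) (A B K : R) :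
    (1 + A + K * (A * B ^ 3)) * ((1 + A * B) * ((1 + B) * (1 + B))) =
      ((1 + A * B) * ((1 + B) * (1 + B)) + K * (A * B ^ 3) * B) * (1 + A) +
        K * (A * B ^ 3) * B ^ 2 * (1 + A + A * B) + A * B ^ 3 * (1 + A + K) := by
  have h2 : (2 : R) = 1 := by exact_mod_cast natCast_succ_eq_one_of_one_add_one h 1
  have h3 : (3 : R) = 1 := by exact_mod_cast natCast_succ_eq_one_of_one_add_one h 2
  ring_nf
  simp only [h2, h3, mul_one]

theorem BoolSemiring.polynomial_one_add_one : (1 : Polynomial 𝔹) + 1 = 1 := by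
  have h : (1 : 𝔹) + 1 = 1 := by decide
  rw [← C_1, ← C_add, h]

theorem stmt_8 (J : Ideal (Polynomial 𝔹)) (hJ : J.IsPrime)
    (hx : (X : Polynomial 𝔹) ∉ J)
    (hfin : (AJ J).Finite) (hne : (AJ J).Nonempty)
    (a : ℕ) (ha : a ∈ AJ J) :
    (∀ q : ℕ, 1 ≤ q → (1 : Polynomial 𝔹) + X ^ a + X ^ q ∈ J) ↔
      ∃ m : ℕ, a < m ∧ (1 : Polynomial 𝔹) + X ^ a + X ^ m ∈ J ∧
        m ∉ AJ J ∧ m - a ∉ AJ J := by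
  have h1 := BoolSemiring.polynomial_one_add_one
  have haJ : (1 : Polynomial 𝔹) + X ^ a ∈ J := ha.2
  constructor
  · intro h
    obtain ⟨M, hM⟩ := hfin.bddAbove
    refine ⟨M + a + 1, by omega, h _ (by omega), fun hc => ?_, fun hc => ?_⟩
    · have := hM hc
      omega
    · have := hM hc
      omega
  · rintro ⟨m, ham, hm, hmA, hbA⟩ q -
    obtain ⟨b, rfl⟩ := Nat.exists_eq_add_of_lt ham
    rw [show a + b + 1 - a = b + 1 by omega] at hbA
    rw [add_assoc a b 1] at hm hmA
    generalize hc : b + 1 = c at hm hmA hbA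
    have hm' : (1 : Polynomial 𝔹) + X ^ (a + c) ∉ J := fun h => hmA ⟨by omega, h⟩
    have hb' : (1 : Polynomial 𝔹) + X ^ c ∉ J := fun h => hbA ⟨by omega, h⟩
    rw [pow_add] at hm hm'
    have hshift (k : ℕ) (hk : (1 : Polynomial 𝔹) + X ^ a + X ^ k ∈ J) :
        (1 : Polynomial 𝔹) + X ^ a + X ^ (k + (a + c * 3)) ∈ J := by
      have hmem : (1 + X ^ a + X ^ k * (X ^ a * (X ^ c) ^ 3)) *
          ((1 + X ^ a * X ^ c) * ((1 + X ^ c) * (1 + X ^ c))) ∈ J := by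
        rw [trinomial_mul_binomials h1]
        exact J.add_mem (J.add_mem (J.mul_mem_left _ haJ) (J.mul_mem_left _ hm))
          (J.mul_mem_left _ hk)
      rw [← pow_mul, ← pow_add, ← pow_add] at hmem
      refine (hJ.mem_or_mem hmem).resolve_right fun h => ?_
      rcases hJ.mem_or_mem h with h | h
      · exact hm' h
      · exact (hJ.mem_or_mem h).elim hb' hb'
    have hmult (k : ℕ) : (1 : Polynomial 𝔹) + X ^ a + X ^ (k * (a + c * 3)) ∈ J := by
      induction k with
      | zero =>
        rw [zero_mul, pow_zero, add_right_comm, h1]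
        exact haJ
      | succ k ih =>
        rw [Nat.succ_mul]
        exact hshift _ ih
    have hdiv (n : ℕ) (hn : (1 : Polynomial 𝔹) + X ^ a + X ^ (q * (n + 1)) ∈ J) :
        (1 : Polynomial 𝔹) + X ^ a + X ^ q ∈ J := by
      induction n with
      | zero => simpa using hn
      | succ n ih =>
        have hmem : ((1 : Polynomial 𝔹) + X ^ a + X ^ (q * (n + 1))) * (1 + X ^ a + X ^ q) ∈ J := by
          rw [trinomial_mul_trinomial h1, ← pow_add, ← Nat.mul_succ]
          exact J.add_mem hn (J.mul_mem_left _ haJ)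
        exact (hJ.mem_or_mem hmem).elim ih id
    refine hdiv (a + c * 3 - 1) ?_
    rw [show a + c * 3 - 1 + 1 = a + c * 3 by omega]
    exact hmult q
end

section
/- Let J be a prime ideal of ℬ[x] with x ∉ J such that 𝔄_J = {a ≥ 1 : 1+x^a ∈ J} is finite and nonempty, and let a ∈ 𝔄_J. If 1+x^a+x^m ∈ J for every m ≥ 1, then for every positive integer n with n ∉ 𝔄_J and n+a ∉ 𝔄_J one has 1+x^n+x^{n+a} ∉ J. -/
open Polynomial

theorem stmt_10 (J : Ideal (Polynomial 𝔹)) (hJ : J.IsPrime)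
    (hx : (X : Polynomial 𝔹) ∉ J)
    (hfin : (AJ J).Finite) (hne : (AJ J).Nonempty)
    (a : ℕ) (ha : a ∈ AJ J)
    (h : ∀ m : ℕ, 1 ≤ m → (1 : Polynomial 𝔹) + X ^ a + X ^ m ∈ J) :
    ∀ n : ℕ, 1 ≤ n → n ∉ AJ J → n + a ∉ AJ J →
      (1 : Polynomial 𝔹) + X ^ n + X ^ (n + a) ∉ J := by
  intro n hn h₁ h₂ hmem
  have idem : ∀ p : Polynomial 𝔹, p + p = p := fun p => by
    have h11 : (1 : 𝔹) + 1 = 1 := by decide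
    have h11' : (1 : Polynomial 𝔹) + 1 = 1 := by
      rw [← C_1, ← C_add, h11]
    rw [← mul_one p, ← mul_add, h11']
  have key : ((1 : Polynomial 𝔹) + X ^ n) * (1 + X ^ (n + a)) =
      (1 + X ^ n + X ^ (n + a)) + X ^ n * (1 + X ^ a + X ^ (n + a)) := by
    calc _ = 1 + X ^ n + X ^ (n + a) + X ^ n * X ^ (n + a) := by
          rw [add_mul, mul_add, mul_add, one_mul, one_mul, mul_one]
          ac_rfl
      _ = 1 + (X ^ n + X ^ n) + (X ^ (n + a) + X ^ (n + a)) + X ^ n * X ^ (n + a) := by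
          rw [idem, idem]
      _ = _ := by
          rw [mul_add, mul_add, mul_one, ← pow_add X n a]
          ac_rfl
  have hprod : ((1 : Polynomial 𝔹) + X ^ n) * (1 + X ^ (n + a)) ∈ J :=
    key ▸ J.add_mem hmem (J.mul_mem_left _ (h (n + a) (by omega)))
  rcases hJ.mem_or_mem hprod with hp | hp
  · exact h₁ ⟨hn, hp⟩
  · exact h₂ ⟨by omega, hp⟩
end

section
/- Let J be a prime ideal of ℬ[x] with x ∉ J such that 𝔄_J = {a ≥ 1 : 1+x^a ∈ J} is finite and nonempty, and let a ∈ 𝔄_J. If 1+x^n+x^{n+a} ∈ J for every positive integer n with n ∉ 𝔄_J and n+a ∉ 𝔄_J, then for every integer m > a with m ∉ 𝔄_J and m−a ∉ 𝔄_J one has 1+x^a+x^m ∉ J. -/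
open Polynomial

theorem BoolSemiring.one_add_X_pow_mul_one_add_X_pow (n a : ℕ) :
    ((1 : Polynomial 𝔹) + X ^ n) * (1 + X ^ (n + a)) =
      (1 + X ^ n + X ^ (n + a)) + X ^ n * (1 + X ^ a + X ^ (n + a)) := by
  calc ((1 : Polynomial 𝔹) + X ^ n) * (1 + X ^ (n + a))
      = 1 + X ^ n + X ^ (n + a) + X ^ n * X ^ (n + a) := by ring
    _ = 1 + (X ^ n + X ^ n) + (X ^ (n + a) + X ^ (n + a)) + X ^ n * X ^ (n + a) := by
        rw [polynomial_add_self, polynomial_add_self]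
    _ = (1 + X ^ n + X ^ (n + a)) + X ^ n * (1 + X ^ a + X ^ (n + a)) := by
        rw [mul_add, mul_add, mul_one, ← pow_add X n a]
        abel

theorem stmt_11 (J : Ideal (Polynomial 𝔹)) (hJ : J.IsPrime)
    (hx : (X : Polynomial 𝔹) ∉ J)
    (hfin : (AJ J).Finite) (hne : (AJ J).Nonempty)
    (a : ℕ) (ha : a ∈ AJ J)
    (h : ∀ n : ℕ, 1 ≤ n → n ∉ AJ J → n + a ∉ AJ J →
      (1 : Polynomial 𝔹) + X ^ n + X ^ (n + a) ∈ J) :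
    ∀ m : ℕ, a < m → m ∉ AJ J → m - a ∉ AJ J →
      (1 : Polynomial 𝔹) + X ^ a + X ^ m ∉ J := by
  intro m ham hm hma hmem
  obtain ⟨n, rfl⟩ := Nat.exists_eq_add_of_le' ham.le
  rw [Nat.add_sub_cancel] at hma
  have hn : 1 ≤ n := by omega
  have h_prod : ((1 : Polynomial 𝔹) + X ^ n) * (1 + X ^ (n + a)) ∈ J := by
    rw [BoolSemiring.one_add_X_pow_mul_one_add_X_pow]
    exact J.add_mem (h n hn hma hm) (J.mul_mem_left _ hmem)
  rcases hJ.mem_or_mem h_prod with h_left | h_right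
  · exact hma ⟨hn, h_left⟩
  · exact hm ⟨by omega, h_right⟩
end

section
/- Let d > 1 be an integer and let J be a prime ideal of ℬ[x] with x ∉ J such that for every positive integer a one has 1+x^a ∈ J if and only if d does not divide a. Then J equals the ideal of ℬ[x] generated by the set {1+x^a+x^m : a ≥ 1, d ∤ a, m ≥ 0} ∪ {1+x^n+x^{n+a} : a ≥ 1, d ∤ a, n ≥ 0}. -/
open Polynomial

section Idempotent

variable {R : Type*} [CommSemiring R]

theorem add_self_of_one_add_one (h : (1 : R) + 1 = 1) (p : R) : p + p = p := by
  have := congrArg (p * ·) h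
  simpa [mul_add] using this

theorem nsmul_self_of_one_add_one (h : (1 : R) + 1 = 1) (p : R) {n : ℕ} (hn : n ≠ 0) :
    n • p = p := by
  induction n with
  | zero => exact absurd rfl hn
  | succ n ih =>
    rcases eq_or_ne n 0 with rfl | h0
    · simp
    · rw [succ_nsmul, ih h0, add_self_of_one_add_one h]

theorem sum_add_eq_right {ι : Type*} (s : Finset ι) (u : ι → R) (q : R)
    (h : ∀ i ∈ s, u i + q = q) : ∑ i ∈ s, u i + q = q := by
  classical
  induction s using Finset.induction_on with
  | empty => simp
  | insert a s ha ih =>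
    rw [Finset.sum_insert ha, add_assoc,
      ih fun i hi => h i (Finset.mem_insert_of_mem hi), h a (Finset.mem_insert_self a s)]

theorem add_sum_of_mem (h : (1 : R) + 1 = 1) {ι : Type*} {s : Finset ι} (u : ι → R) {i : ι}
    (hi : i ∈ s) : u i + ∑ j ∈ s, u j = ∑ j ∈ s, u j := by
  classical
  rw [← Finset.add_sum_erase s u hi, ← add_assoc, add_self_of_one_add_one h]

theorem one_add_pow_eq_sum_range (h : (1 : R) + 1 = 1) (y : R) (k : ℕ) :
    (1 + y) ^ k = ∑ j ∈ Finset.range (k + 1), y ^ j := by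
  have hs : ∀ k, ∑ j ∈ Finset.range (k + 1), y ^ j =
      1 + y * ∑ j ∈ Finset.range k, y ^ j := fun k => by
    rw [Finset.sum_range_succ', Finset.mul_sum, add_comm, pow_zero]
    simp only [pow_succ']
  induction k with
  | zero => simp
  | succ k ih =>
    have hk : y * ∑ j ∈ Finset.range k, y ^ j + y * ∑ j ∈ Finset.range (k + 1), y ^ j =
        y * ∑ j ∈ Finset.range (k + 1), y ^ j := by
      rw [Finset.sum_range_succ, ← mul_add, ← add_assoc, add_self_of_one_add_one h]
    rw [pow_succ, ih, hs (k + 1), mul_add, mul_one, mul_comm _ y]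
    nth_rewrite 1 [hs k]
    rw [add_assoc, hk]

theorem pow_add_one_add_pow (h : (1 : R) + 1 = 1) (y : R) {i k : ℕ} (hik : i ≤ k) :
    y ^ i + (1 + y) ^ k = (1 + y) ^ k := by
  rw [one_add_pow_eq_sum_range h]
  exact add_sum_of_mem h (fun j => y ^ j) (Finset.mem_range_succ_iff.mpr hik)

theorem one_add_pow_mul_one_add_pow (h : (1 : R) + 1 = 1) (y : R) (k : ℕ) :
    (1 + y ^ k) * (1 + y) ^ k = (1 + y) ^ k * (1 + y) ^ k := by
  have h1 : 1 + (1 + y) ^ k = (1 + y) ^ k := by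
    simpa using pow_add_one_add_pow h y (Nat.zero_le k)
  have h2 : (1 + y) ^ (k + k) = ∑ j ∈ Finset.range k, y ^ j + y ^ k * (1 + y) ^ k := by
    rw [one_add_pow_eq_sum_range h, one_add_pow_eq_sum_range h, add_assoc k k 1,
      Finset.sum_range_add, Finset.mul_sum]
    simp only [pow_add]
  have h3 : (1 + y) ^ k = ∑ j ∈ Finset.range k, y ^ j + y ^ k := by
    rw [one_add_pow_eq_sum_range h, Finset.sum_range_succ]
  rw [← pow_add, h2, add_mul, one_mul]
  nth_rewrite 1 [h3]
  rw [add_assoc]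
  congr 1
  calc y ^ k + y ^ k * (1 + y) ^ k = y ^ k * (1 + (1 + y) ^ k) := by ring
    _ = y ^ k * (1 + y) ^ k := by rw [h1]

end Idempotent

namespace BoolSemiring

theorem one_add_one : (1 : 𝔹) + 1 = 1 := by decide

theorem eq_one_of_ne_zero : ∀ c : 𝔹, c ≠ 0 → c = 1 := by decide

theorem polynomial_one_add_one_s13 : (1 : 𝔹[X]) + 1 = 1 := by
  rw [← C_1, ← C_add, one_add_one]

theorem eq_sum_support (g : 𝔹[X]) : g = ∑ m ∈ g.support, X ^ m := by
  conv_lhs => rw [g.as_sum_support_C_mul_X_pow]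
  refine Finset.sum_congr rfl fun m hm => ?_
  rw [eq_one_of_ne_zero _ (mem_support_iff.mp hm), C_1, one_mul]

theorem X_pow_add_of_mem_support {g : 𝔹[X]} {m : ℕ} (hm : m ∈ g.support) : X ^ m + g = g := by
  conv_rhs => rw [eq_sum_support g, ← add_sum_of_mem polynomial_one_add_one_s13 _ hm,
    ← eq_sum_support g]

theorem mem_of_forall_one_add_X_pow_add_X_pow_mem {I : Ideal 𝔹[X]} {g : 𝔹[X]} {a : ℕ}
    (h0 : 0 ∈ g.support) (ha : a ∈ g.support) (h : ∀ m, 1 + X ^ a + X ^ m ∈ I) : g ∈ I := by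
  have hg : ∑ m ∈ g.support, (1 + X ^ a + X ^ m) = g := by
    rw [Finset.sum_add_distrib, Finset.sum_const, ← eq_sum_support,
      nsmul_self_of_one_add_one polynomial_one_add_one_s13 _ (Finset.card_ne_zero_of_mem h0),
      add_assoc, X_pow_add_of_mem_support ha]
    simpa using X_pow_add_of_mem_support h0
  rw [← hg]
  exact I.sum_mem fun m _ => h m

theorem mul_one_add_X_pow_pow {g : 𝔹[X]} {d k : ℕ} (h0 : 0 ∈ g.support)
    (hg : ∀ m ∈ g.support, d ∣ m) (hd : 0 < d) (hk : g.natDegree = d * k) :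
    g * (1 + X ^ d) ^ k = (1 + X ^ d) ^ (k + k) := by
  have hle : g + (1 + X ^ d) ^ k = (1 + X ^ d) ^ k := by
    nth_rewrite 1 [eq_sum_support g]
    refine sum_add_eq_right _ _ _ fun m hm => ?_
    obtain ⟨i, rfl⟩ := hg m hm
    rw [pow_mul]
    refine pow_add_one_add_pow polynomial_one_add_one_s13 _ ?_
    exact Nat.le_of_mul_le_mul_left (hk ▸ le_natDegree_of_mem_supp _ hm) hd
  have hg0 : g ≠ 0 := by rintro rfl; simp at h0
  have htop : g = g + (1 + (X ^ d) ^ k) := by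
    rw [← pow_mul, ← hk, add_comm, add_assoc,
      X_pow_add_of_mem_support (natDegree_mem_support_of_nonzero hg0)]
    simpa using (X_pow_add_of_mem_support h0).symm
  nth_rewrite 1 [htop]
  rw [add_mul, one_add_pow_mul_one_add_pow polynomial_one_add_one_s13, ← add_mul, hle, pow_add]

theorem X_pow_add_X_pow_mem {J : Ideal 𝔹[X]} {d : ℕ}
    (hA : ∀ a : ℕ, 1 ≤ a → ¬ d ∣ a → 1 + X ^ a ∈ J) {i j : ℕ} (h : ¬ i ≡ j [MOD d]) :
    X ^ i + X ^ j ∈ J := by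
  wlog hij : i ≤ j generalizing i j
  · rw [add_comm]
    exact this (fun h' => h h'.symm) (Nat.le_of_not_le hij)
  have hdvd : ¬ d ∣ j - i := fun h' => h ((Nat.modEq_iff_dvd' hij).mpr h')
  have hne : 1 ≤ j - i := Nat.one_le_iff_ne_zero.mpr fun h0 => hdvd (h0 ▸ dvd_zero d)
  have := J.mul_mem_left (X ^ i) (hA _ hne hdvd)
  rwa [mul_add, mul_one, ← pow_add, Nat.add_sub_cancel' hij] at this

theorem X_pow_add_X_pow_add_X_pow_mem {J : Ideal 𝔹[X]} {d : ℕ}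
    (hA : ∀ a : ℕ, 1 ≤ a → ¬ d ∣ a → 1 + X ^ a ∈ J) {i j : ℕ} (h : ¬ i ≡ j [MOD d]) (m : ℕ) :
    X ^ i + X ^ j + X ^ m ∈ J := by
  have hij := X_pow_add_X_pow_mem hA h
  by_cases hm : i ≡ m [MOD d]
  · have hjm := X_pow_add_X_pow_mem hA fun h' : j ≡ m [MOD d] => h (hm.trans h'.symm)
    have := J.add_mem hij hjm
    rwa [← add_assoc, add_assoc (X ^ i),
      add_self_of_one_add_one polynomial_one_add_one_s13] at this
  · have := J.add_mem hij (X_pow_add_X_pow_mem hA hm)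
    rwa [add_comm (X ^ i) (X ^ j), ← add_assoc, add_assoc (X ^ j),
      add_self_of_one_add_one polynomial_one_add_one_s13, add_comm (X ^ j)] at this

end BoolSemiring

open BoolSemiring in
theorem stmt_13 (d : ℕ) (hd : 1 < d)
    (J : Ideal (Polynomial 𝔹)) (hJ : J.IsPrime)
    (hx : (X : Polynomial 𝔹) ∉ J)
    (hA : ∀ a : ℕ, 1 ≤ a → ((1 : Polynomial 𝔹) + X ^ a ∈ J ↔ ¬ d ∣ a)) :
    J = Ideal.span
      ({f : Polynomial 𝔹 | ∃ a : ℕ, 1 ≤ a ∧ ¬ d ∣ a ∧ ∃ m : ℕ, f = 1 + X ^ a + X ^ m} ∪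
       {f : Polynomial 𝔹 | ∃ a : ℕ, 1 ≤ a ∧ ¬ d ∣ a ∧ ∃ n : ℕ, f = 1 + X ^ n + X ^ (n + a)}) := by
  have hA' : ∀ a : ℕ, 1 ≤ a → ¬ d ∣ a → 1 + X ^ a ∈ J := fun a ha => (hA a ha).mpr
  apply le_antisymm
  · intro f hf
    rcases eq_or_ne f 0 with rfl | hf0
    · exact Ideal.zero_mem _
    obtain ⟨g, hg⟩ : X ^ f.natTrailingDegree ∣ f :=
      X_pow_dvd_iff.mpr fun _ h => coeff_eq_zero_of_lt_natTrailingDegree h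
    have hgJ : g ∈ J := (hJ.mem_or_mem (hg ▸ hf)).resolve_left
      fun h => hx (hJ.mem_of_pow_mem _ h)
    have h0 : 0 ∈ g.support := by
      rw [mem_support_iff]
      intro h
      apply hf0
      rw [← coeff_natTrailingDegree_eq_zero]
      have := coeff_X_pow_mul g f.natTrailingDegree 0
      rwa [← hg, zero_add, h] at this
    rw [hg]
    refine Ideal.mul_mem_left _ _ ?_
    by_cases hdvd : ∀ m ∈ g.support, d ∣ m
    · have hg0 : g ≠ 0 := by rintro rfl; simp at h0
      obtain ⟨k, hk⟩ := hdvd _ (natDegree_mem_support_of_nonzero hg0)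
      have hmem := J.mul_mem_right ((1 + X ^ d) ^ k) hgJ
      rw [mul_one_add_X_pow_pow h0 hdvd (by lia) hk] at hmem
      exact absurd dvd_rfl ((hA d hd.le).mp (hJ.mem_of_pow_mem _ hmem))
    · push Not at hdvd
      obtain ⟨a, ha, hda⟩ := hdvd
      have ha1 : 1 ≤ a := Nat.one_le_iff_ne_zero.mpr fun h => hda (h ▸ dvd_zero d)
      exact mem_of_forall_one_add_X_pow_add_X_pow_mem h0 ha fun m =>
        Ideal.subset_span (Or.inl ⟨a, ha1, hda, m, rfl⟩)
  · rw [Ideal.span_le]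
    rintro f (⟨a, -, hda, m, rfl⟩ | ⟨a, -, hda, n, rfl⟩)
    · have h : ¬ 0 ≡ a [MOD d] := fun h => hda ((Nat.modEq_zero_iff_dvd).mp h.symm)
      simpa using X_pow_add_X_pow_add_X_pow_mem hA' h m
    · have h : ¬ n ≡ n + a [MOD d] := fun h => hda (by
        simpa using (Nat.modEq_iff_dvd' (Nat.le_add_right n a)).mp h)
      have := X_pow_add_X_pow_add_X_pow_mem hA' h 0
      rwa [add_comm _ (X ^ 0), pow_zero, ← add_assoc] at this
end

section
/- Let J be a prime ideal of ℬ[x] with x ∉ J and let d > 1 be an integer such that every positive integer n with 1+x^n ∉ J is divisible by d. If a is a positive integer with 1+x^a ∈ J and d ∤ a, then 1+x^a+x^m ∈ J for every m ≥ 1, and 1+x^{m−a}+x^m ∈ J for every m > a. -/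
open Polynomial

theorem stmt_14 (J : Ideal (Polynomial 𝔹)) (hJ : J.IsPrime)
    (hx : (X : Polynomial 𝔹) ∉ J)
    (d : ℕ) (hd : 1 < d)
    (hdvd : ∀ n : ℕ, 1 ≤ n → (1 : Polynomial 𝔹) + X ^ n ∉ J → d ∣ n)
    (a : ℕ) (ha : 1 ≤ a) (haJ : (1 : Polynomial 𝔹) + X ^ a ∈ J) (hda : ¬ d ∣ a) :
    (∀ m : ℕ, 1 ≤ m → (1 : Polynomial 𝔹) + X ^ a + X ^ m ∈ J) ∧
    (∀ m : ℕ, a < m → (1 : Polynomial 𝔹) + X ^ (m - a) + X ^ m ∈ J) := by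
  have hmem : ∀ n : ℕ, ¬ d ∣ n → (1 : Polynomial 𝔹) + X ^ n ∈ J := fun n hn => by
    by_contra h
    exact hn (hdvd n (Nat.pos_of_ne_zero fun h0 => hn (h0 ▸ dvd_zero d)) h)
  have hshift : ∀ k l : ℕ, ¬ d ∣ l → (X : Polynomial 𝔹) ^ k + X ^ (k + l) ∈ J := fun k l hl => by
    simpa [mul_add, pow_add] using J.mul_mem_left (X ^ k) (hmem l hl)
  have hjoin : ∀ p q r : Polynomial 𝔹, p + q ∈ J → q + r ∈ J → p + q + r ∈ J :=
    fun p q r hpq hqr => by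
      have h := J.add_mem hpq hqr
      rwa [show p + q + (q + r) = p + (q + q) + r by ring,
        BoolSemiring.polynomial_add_self] at h
  refine ⟨fun m _ => ?_, fun m hm => ?_⟩
  · by_cases hdm : d ∣ m
    · refine hjoin _ _ _ haJ ?_
      rcases le_total a m with h | h
      · obtain ⟨l, rfl⟩ := Nat.exists_eq_add_of_le h
        exact hshift a l fun hl => hda ((Nat.dvd_add_left hl).mp hdm)
      · obtain ⟨l, rfl⟩ := Nat.exists_eq_add_of_le h
        rw [add_comm]
        exact hshift m l fun hl => hda (dvd_add hdm hl)
    · rw [add_comm 1]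
      exact hjoin _ _ _ (by rwa [add_comm]) (hmem m hdm)
  · obtain ⟨k, rfl⟩ := Nat.exists_eq_add_of_le' hm.le
    rw [Nat.add_sub_cancel]
    by_cases hdm : d ∣ k + a
    · exact hjoin _ _ _ (hmem k fun hk => hda ((Nat.dvd_add_right hk).mp hdm)) (hshift k a hda)
    · rw [add_right_comm]
      exact hjoin _ _ _ (hmem _ hdm) (by rw [add_comm]; exact hshift k a hda)
end
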